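/- arXiv:1403.2117 — 3 statements merged into one kernel-verified Lean document; each statement's English description precedes it below -/
import Mathlib

section
/- Strong fatness for the Wallach flag manifold W¹² = Sp(3)/Sp(1)Sp(1)Sp(1): let g = sp(3) (quaternionic 3×3 matrices X with X* = −X) with inner product Q(X,Y) = −Re tr(XY), let k = {diag(A, q) : A ∈ sp(2), q ∈ sp(1)} (block-diagonal sp(2)⊕sp(1)), and let h = {diag(q₁, q₂, q₃) : qᵢ ∈ Im ℍ} ⊂ k. Let m be the Q-orthogonal complement of k in g and p the Q-orthogonal complement of h in k. Then there exists τ ∈ Λ²m⊗Λ²p such that the operator F + τ restricted to m⊗p is positive-definite. -/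
/- Common setup: an abstract model of the second and fourth exterior powers
`Λ²V` and `Λ⁴V` of a real inner product space `V`, with the induced inner
products, the identification of 4-vectors with self-adjoint operators on
`Λ²V`, and the Bianchi map. -/

noncomputable section

open scoped InnerProductSpace

/-- A linear operator on a real inner product space is positive-semidefinite. -/
def IsPosSemidef {E : Type*} [NormedAddCommGroup E] [InnerProductSpace ℝ E]
    (T : E →ₗ[ℝ] E) : Prop :=
  ∀ v : E, 0 ≤ ⟪T v, v⟫_ℝ

/-- A linear operator on a real inner product space is positive-definite. -/
def IsPosDef {E : Type*} [NormedAddCommGroup E] [InnerProductSpace ℝ E]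
    (T : E →ₗ[ℝ] E) : Prop :=
  ∀ v : E, v ≠ 0 → 0 < ⟪T v, v⟫_ℝ

/-- An abstract model of the exterior powers `Λ²V` (the type `E2`) and `Λ⁴V`
(the type `E4`) of a real inner product space `V`:
* `wedge2 X Y` models `X ∧ Y ∈ Λ²V` and `wedge4 X Y Z W` models
  `X ∧ Y ∧ Z ∧ W ∈ Λ⁴V`; both are alternating, and their images span.
* The inner products are the induced ones, given by Gram determinants.
* `wedge22` models the wedge product `Λ²V × Λ²V → Λ⁴V`.
* `toOp ω` is the self-adjoint operator on `Λ²V` associated to `ω ∈ Λ⁴V`,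
  determined by `⟪toOp ω (X ∧ Y), Z ∧ W⟫ = ω(X,Y,Z,W) = ⟪ω, X ∧ Y ∧ Z ∧ W⟫`
  (using the identification of `Λ⁴V` with 4-forms via the inner product). -/
structure ExtModel (V E2 E4 : Type*)
    [NormedAddCommGroup V] [InnerProductSpace ℝ V]
    [NormedAddCommGroup E2] [InnerProductSpace ℝ E2]
    [NormedAddCommGroup E4] [InnerProductSpace ℝ E4] where
  wedge2 : V →ₗ[ℝ] V →ₗ[ℝ] E2
  wedge4 : V →ₗ[ℝ] V →ₗ[ℝ] V →ₗ[ℝ] V →ₗ[ℝ] E4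
  wedge22 : E2 →ₗ[ℝ] E2 →ₗ[ℝ] E4
  toOp : E4 →ₗ[ℝ] E2 →ₗ[ℝ] E2
  wedge2_self : ∀ X : V, wedge2 X X = 0
  wedge4_self₁₂ : ∀ X Z W : V, wedge4 X X Z W = 0
  wedge4_self₂₃ : ∀ X Y W : V, wedge4 X Y Y W = 0
  wedge4_self₃₄ : ∀ X Y Z : V, wedge4 X Y Z Z = 0
  span_wedge2 : Submodule.span ℝ {σ : E2 | ∃ X Y : V, σ = wedge2 X Y} = ⊤
  span_wedge4 : Submodule.span ℝ {ω : E4 | ∃ X Y Z W : V, ω = wedge4 X Y Z W} = ⊤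
  inner_wedge2 : ∀ X Y Z W : V,
    ⟪wedge2 X Y, wedge2 Z W⟫_ℝ = ⟪X, Z⟫_ℝ * ⟪Y, W⟫_ℝ - ⟪X, W⟫_ℝ * ⟪Y, Z⟫_ℝ
  inner_wedge4 : ∀ x y : Fin 4 → V,
    ⟪wedge4 (x 0) (x 1) (x 2) (x 3), wedge4 (y 0) (y 1) (y 2) (y 3)⟫_ℝ
      = Matrix.det (Matrix.of fun i j : Fin 4 => ⟪x i, y j⟫_ℝ)
  wedge22_spec : ∀ X Y Z W : V, wedge22 (wedge2 X Y) (wedge2 Z W) = wedge4 X Y Z W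
  toOp_spec : ∀ (ω : E4) (X Y Z W : V),
    ⟪toOp ω (wedge2 X Y), wedge2 Z W⟫_ℝ = ⟪ω, wedge4 X Y Z W⟫_ℝ

namespace ExtModel

variable {V E2 E4 : Type*} [NormedAddCommGroup V] [InnerProductSpace ℝ V]
  [NormedAddCommGroup E2] [InnerProductSpace ℝ E2]
  [NormedAddCommGroup E4] [InnerProductSpace ℝ E4]

/-- The Bianchi map: the 4-linear form associated to an operator
`R : Λ²V → Λ²V` by `b(R)(X,Y,Z,W) = (1/3)(⟪R(X∧Y), Z∧W⟫ + ⟪R(Y∧Z), X∧W⟫ +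
⟪R(Z∧X), Y∧W⟫)`. -/
def bianchi (M : ExtModel V E2 E4) (R : E2 →ₗ[ℝ] E2) (X Y Z W : V) : ℝ :=
  (1 / 3) * (⟪R (M.wedge2 X Y), M.wedge2 Z W⟫_ℝ + ⟪R (M.wedge2 Y Z), M.wedge2 X W⟫_ℝ
    + ⟪R (M.wedge2 Z X), M.wedge2 Y W⟫_ℝ)

end ExtModel

open scoped Quaternion

/-- The element of `sp(3)` with entries `x`, `y` above the diagonal in the last column; these
matrices make up `m`. -/
def lastColumnMatrix (x y : ℍ[ℝ]) : Matrix (Fin 3) (Fin 3) ℍ[ℝ] :=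
  !![0, 0, x; 0, 0, y; -star x, -star y, 0]

/-- The element of `sp(3)` with `(0,1)` entry `z`; these matrices make up `p`. -/
def upperLeftMatrix (z : ℍ[ℝ]) : Matrix (Fin 3) (Fin 3) ℍ[ℝ] :=
  !![0, z, 0; -star z, 0, 0; 0, 0, 0]

/-- The standard basis `1, i, j, k` of the quaternions. -/
def quaternionUnit : Fin 4 → ℍ[ℝ] :=
  ![⟨1, 0, 0, 0⟩, ⟨0, 1, 0, 0⟩, ⟨0, 0, 1, 0⟩, ⟨0, 0, 0, 1⟩]

open Matrix in
theorem lastColumnMatrix_conjTranspose (x y : ℍ[ℝ]) :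
    (lastColumnMatrix x y)ᴴ = -lastColumnMatrix x y := by
  ext i j : 1
  fin_cases i <;> fin_cases j <;> simp [lastColumnMatrix]

open Matrix in
theorem upperLeftMatrix_conjTranspose (z : ℍ[ℝ]) :
    (upperLeftMatrix z)ᴴ = -upperLeftMatrix z := by
  ext i j : 1
  fin_cases i <;> fin_cases j <;> simp [upperLeftMatrix]

theorem trace_lastColumnMatrix_mul (x y x' y' : ℍ[ℝ]) :
    -(Matrix.trace (lastColumnMatrix x y * lastColumnMatrix x' y')).re =
      2 * (x.re * x'.re + x.imI * x'.imI + x.imJ * x'.imJ + x.imK * x'.imK +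
        (y.re * y'.re + y.imI * y'.imI + y.imJ * y'.imJ + y.imK * y'.imK)) := by
  simp [lastColumnMatrix, Matrix.trace_fin_three]
  ring

theorem trace_upperLeftMatrix_mul (z z' : ℍ[ℝ]) :
    -(Matrix.trace (upperLeftMatrix z * upperLeftMatrix z')).re =
      2 * (z.re * z'.re + z.imI * z'.imI + z.imJ * z'.imJ + z.imK * z'.imK) := by
  simp [upperLeftMatrix, Matrix.trace_fin_three]
  ring

theorem trace_quaternionUnit_left (i : Fin 4) (x y : ℍ[ℝ]) :
    -(Matrix.trace (lastColumnMatrix (quaternionUnit i) 0 * lastColumnMatrix x y)).re =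
      2 * ![x.re, x.imI, x.imJ, x.imK] i := by
  rw [trace_lastColumnMatrix_mul]
  fin_cases i <;> simp [quaternionUnit]

theorem trace_quaternionUnit_right (i : Fin 4) (x y : ℍ[ℝ]) :
    -(Matrix.trace (lastColumnMatrix 0 (quaternionUnit i) * lastColumnMatrix x y)).re =
      2 * ![y.re, y.imI, y.imJ, y.imK] i := by
  rw [trace_lastColumnMatrix_mul]
  fin_cases i <;> simp [quaternionUnit]

theorem trace_quaternionUnit_upper (i : Fin 4) (z : ℍ[ℝ]) :
    -(Matrix.trace (upperLeftMatrix (quaternionUnit i) * upperLeftMatrix z)).re =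
      2 * ![z.re, z.imI, z.imJ, z.imK] i := by
  rw [trace_upperLeftMatrix_mul]
  fin_cases i <;> simp [quaternionUnit]

theorem trace_star_quaternionUnit_upper (i : Fin 4) (z : ℍ[ℝ]) :
    -(Matrix.trace (upperLeftMatrix (star (quaternionUnit i)) * upperLeftMatrix z)).re =
      2 * ![z.re, -z.imI, -z.imJ, -z.imK] i := by
  rw [trace_upperLeftMatrix_mul, Quaternion.re_star, Quaternion.imI_star, Quaternion.imJ_star,
    Quaternion.imK_star]
  fin_cases i <;> simp [quaternionUnit]

theorem lastColumnMatrix_bracket_upperLeftMatrix (x y z : ℍ[ℝ]) :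
    lastColumnMatrix x y * upperLeftMatrix z - upperLeftMatrix z * lastColumnMatrix x y =
      lastColumnMatrix (-(z * y)) (star z * x) := by
  ext i j : 1
  fin_cases i <;> fin_cases j <;>
    simp [lastColumnMatrix, upperLeftMatrix]

theorem re_mul_self_of_eq_neg_star {a b : ℍ[ℝ]} (h : a = -star b) :
    (b * a).re = -Quaternion.normSq b := by
  rw [h, mul_neg, Quaternion.self_mul_star, Quaternion.re_neg, Quaternion.re_coe]

open Matrix in
theorem apply_eq_neg_star_of_conjTranspose_eq_neg {A : Matrix (Fin 3) (Fin 3) ℍ[ℝ]}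
    (hA : Aᴴ = -A) (i j : Fin 3) : A i j = -star (A j i) := by
  rw [← conjTranspose_apply, hA, neg_apply, neg_neg]

open Matrix in
/-- The upper left block of a skew-Hermitian matrix vanishes, together with its last diagonal
entry, if the matrix is orthogonal to its own block-diagonal part. -/
theorem eq_lastColumnMatrix_of_trace_eq_zero {A : Matrix (Fin 3) (Fin 3) ℍ[ℝ]} (hA : Aᴴ = -A)
    (h : -(Matrix.trace
      (!![A 0 0, A 0 1, 0; A 1 0, A 1 1, 0; 0, 0, A 2 2] * A)).re = 0) :
    A = lastColumnMatrix (A 0 2) (A 1 2) := by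
  have hs := apply_eq_neg_star_of_conjTranspose_eq_neg hA
  have hn : ∀ i j, 0 ≤ Quaternion.normSq (A i j) := fun _ _ => Quaternion.normSq_nonneg
  have h' : Quaternion.normSq (A 0 0) + Quaternion.normSq (A 0 1) + Quaternion.normSq (A 1 0) +
      Quaternion.normSq (A 1 1) + Quaternion.normSq (A 2 2) = 0 := by
    have e := fun i j => re_mul_self_of_eq_neg_star (hs i j)
    simp [Matrix.trace_fin_three, Matrix.vecMul, dotProduct, Fin.sum_univ_three,
      -Quaternion.re_mul, e] at h
    linarith
  have h₀ : A 0 0 = 0 := Quaternion.normSq_eq_zero.1 <| by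
    linarith [hn 0 0, hn 0 1, hn 1 0, hn 1 1, hn 2 2]
  have h₁ : A 0 1 = 0 := Quaternion.normSq_eq_zero.1 <| by
    linarith [hn 0 0, hn 0 1, hn 1 0, hn 1 1, hn 2 2]
  have h₂ : A 1 0 = 0 := by rw [hs, h₁, star_zero, neg_zero]
  have h₃ : A 1 1 = 0 := Quaternion.normSq_eq_zero.1 <| by
    linarith [hn 0 0, hn 0 1, hn 1 0, hn 1 1, hn 2 2]
  have h₄ : A 2 2 = 0 := Quaternion.normSq_eq_zero.1 <| by
    linarith [hn 0 0, hn 0 1, hn 1 0, hn 1 1, hn 2 2]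
  ext i j : 1
  fin_cases i <;> fin_cases j <;> simp [lastColumnMatrix, h₀, h₁, h₂, h₃, h₄, hs 2 0, hs 2 1]

open Matrix in
/-- A skew-Hermitian block-diagonal matrix orthogonal to its own diagonal part has zero
diagonal. -/
theorem eq_upperLeftMatrix_of_trace_eq_zero {A : Matrix (Fin 3) (Fin 3) ℍ[ℝ]} (hA : Aᴴ = -A)
    (hK : A 0 2 = 0 ∧ A 1 2 = 0 ∧ A 2 0 = 0 ∧ A 2 1 = 0)
    (h : -(Matrix.trace (!![A 0 0, 0, 0; 0, A 1 1, 0; 0, 0, A 2 2] * A)).re = 0) :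
    A = upperLeftMatrix (A 0 1) := by
  have hs := apply_eq_neg_star_of_conjTranspose_eq_neg hA
  have hn : ∀ i, 0 ≤ Quaternion.normSq (A i i) := fun _ => Quaternion.normSq_nonneg
  have h' : Quaternion.normSq (A 0 0) + Quaternion.normSq (A 1 1) +
      Quaternion.normSq (A 2 2) = 0 := by
    have e := fun i j => re_mul_self_of_eq_neg_star (hs i j)
    simp [Matrix.trace_fin_three, Matrix.vecMul, dotProduct, Fin.sum_univ_three,
      -Quaternion.re_mul, e] at h
    linarith
  have h₀ : A 0 0 = 0 := Quaternion.normSq_eq_zero.1 <| by linarith [hn 0, hn 1, hn 2]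
  have h₁ : A 1 1 = 0 := Quaternion.normSq_eq_zero.1 <| by linarith [hn 0, hn 1, hn 2]
  have h₂ : A 2 2 = 0 := Quaternion.normSq_eq_zero.1 <| by linarith [hn 0, hn 1, hn 2]
  obtain ⟨h₃, h₄, h₅, h₆⟩ := hK
  ext i j : 1
  fin_cases i <;> fin_cases j <;>
    simp [upperLeftMatrix, h₀, h₁, h₂, h₃, h₄, h₅, h₆, hs 1 0]

namespace ExtModel

variable {V E2 E4 : Type*} [NormedAddCommGroup V] [InnerProductSpace ℝ V]
  [NormedAddCommGroup E2] [InnerProductSpace ℝ E2]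
  [NormedAddCommGroup E4] [InnerProductSpace ℝ E4]

theorem inner_wedge4_of_orthogonal (M : ExtModel V E2 E4) {A B C D X Y Z W : V}
    (hAY : ⟪A, Y⟫_ℝ = 0) (hAW : ⟪A, W⟫_ℝ = 0) (hBY : ⟪B, Y⟫_ℝ = 0) (hBW : ⟪B, W⟫_ℝ = 0)
    (hCX : ⟪C, X⟫_ℝ = 0) (hCZ : ⟪C, Z⟫_ℝ = 0) (hDX : ⟪D, X⟫_ℝ = 0) (hDZ : ⟪D, Z⟫_ℝ = 0) :
    ⟪M.wedge4 A B C D, M.wedge4 X Y Z W⟫_ℝ =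
      -((⟪A, X⟫_ℝ * ⟪B, Z⟫_ℝ - ⟪A, Z⟫_ℝ * ⟪B, X⟫_ℝ) *
        (⟪C, Y⟫_ℝ * ⟪D, W⟫_ℝ - ⟪C, W⟫_ℝ * ⟪D, Y⟫_ℝ)) := by
  have h := M.inner_wedge4 ![A, B, C, D] ![X, Y, Z, W]
  simp [Matrix.det_succ_row_zero, Fin.sum_univ_succ, Fin.succAbove, hAY, hAW, hBY, hBW, hCX, hCZ,
    hDX, hDZ] at h
  rw [h]
  ring

/-- The 4-vector `∑ₖ ωₖ ∧ βₖ`, where `ωₖ` and `βₖ` run through the standard bases of the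
self-dual 2-vectors associated to the quadruples `a` and `c`. -/
def selfDualWedge (M : ExtModel V E2 E4) (a c : Fin 4 → V) : E4 :=
  M.wedge22 (M.wedge2 (a 0) (a 1) + M.wedge2 (a 2) (a 3))
      (M.wedge2 (c 0) (c 1) + M.wedge2 (c 2) (c 3)) +
    M.wedge22 (M.wedge2 (a 0) (a 2) + M.wedge2 (a 3) (a 1))
      (M.wedge2 (c 0) (c 2) + M.wedge2 (c 3) (c 1)) +
    M.wedge22 (M.wedge2 (a 0) (a 3) + M.wedge2 (a 1) (a 2))
      (M.wedge2 (c 0) (c 3) + M.wedge2 (c 1) (c 2))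

theorem selfDualWedge_mem_span (M : ExtModel V E2 E4) {m p : Submodule ℝ V} {a c : Fin 4 → V}
    (ha : ∀ i, a i ∈ m) (hc : ∀ i, c i ∈ p) :
    M.selfDualWedge a c ∈ Submodule.span ℝ
      {ω : E4 | ∃ X Y Z W : V, X ∈ m ∧ Y ∈ m ∧ Z ∈ p ∧ W ∈ p ∧ ω = M.wedge4 X Y Z W} := by
  have h : ∀ i j k l, M.wedge4 (a i) (a j) (c k) (c l) ∈ Submodule.span ℝ
      {ω : E4 | ∃ X Y Z W : V, X ∈ m ∧ Y ∈ m ∧ Z ∈ p ∧ W ∈ p ∧ ω = M.wedge4 X Y Z W} :=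
    fun i j k l => Submodule.subset_span ⟨_, _, _, _, ha i, ha j, hc k, hc l, rfl⟩
  simp only [selfDualWedge, map_add, LinearMap.add_apply, M.wedge22_spec]
  repeat' apply Submodule.add_mem
  all_goals apply h

theorem inner_selfDualWedge (M : ExtModel V E2 E4) {a c : Fin 4 → V} {X Y Z W : V}
    (hY : ∀ i, ⟪a i, Y⟫_ℝ = 0) (hW : ∀ i, ⟪a i, W⟫_ℝ = 0)
    (hX : ∀ i, ⟪c i, X⟫_ℝ = 0) (hZ : ∀ i, ⟪c i, Z⟫_ℝ = 0) :
    ⟪M.selfDualWedge a c, M.wedge4 X Y Z W⟫_ℝ =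
      -((⟪a 0, X⟫_ℝ * ⟪a 1, Z⟫_ℝ - ⟪a 0, Z⟫_ℝ * ⟪a 1, X⟫_ℝ +
            (⟪a 2, X⟫_ℝ * ⟪a 3, Z⟫_ℝ - ⟪a 2, Z⟫_ℝ * ⟪a 3, X⟫_ℝ)) *
          (⟪c 0, Y⟫_ℝ * ⟪c 1, W⟫_ℝ - ⟪c 0, W⟫_ℝ * ⟪c 1, Y⟫_ℝ +
            (⟪c 2, Y⟫_ℝ * ⟪c 3, W⟫_ℝ - ⟪c 2, W⟫_ℝ * ⟪c 3, Y⟫_ℝ)) +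
        (⟪a 0, X⟫_ℝ * ⟪a 2, Z⟫_ℝ - ⟪a 0, Z⟫_ℝ * ⟪a 2, X⟫_ℝ +
            (⟪a 3, X⟫_ℝ * ⟪a 1, Z⟫_ℝ - ⟪a 3, Z⟫_ℝ * ⟪a 1, X⟫_ℝ)) *
          (⟪c 0, Y⟫_ℝ * ⟪c 2, W⟫_ℝ - ⟪c 0, W⟫_ℝ * ⟪c 2, Y⟫_ℝ +
            (⟪c 3, Y⟫_ℝ * ⟪c 1, W⟫_ℝ - ⟪c 3, W⟫_ℝ * ⟪c 1, Y⟫_ℝ)) +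
        (⟪a 0, X⟫_ℝ * ⟪a 3, Z⟫_ℝ - ⟪a 0, Z⟫_ℝ * ⟪a 3, X⟫_ℝ +
            (⟪a 1, X⟫_ℝ * ⟪a 2, Z⟫_ℝ - ⟪a 1, Z⟫_ℝ * ⟪a 2, X⟫_ℝ)) *
          (⟪c 0, Y⟫_ℝ * ⟪c 3, W⟫_ℝ - ⟪c 0, W⟫_ℝ * ⟪c 3, Y⟫_ℝ +
            (⟪c 1, Y⟫_ℝ * ⟪c 2, W⟫_ℝ - ⟪c 1, W⟫_ℝ * ⟪c 2, Y⟫_ℝ))) := by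
  simp only [selfDualWedge, map_add, LinearMap.add_apply, M.wedge22_spec, inner_add_left,
    M.inner_wedge4_of_orthogonal (hY _) (hW _) (hY _) (hW _) (hX _) (hZ _) (hX _) (hZ _)]
  ring

/-- An operator whose bilinear form agrees on decomposable 2-vectors with a positive multiple of
the inner product is positive-definite on their span. -/
theorem inner_pos_of_forall_wedge2 (M : ExtModel V E2 E4) {m p : Submodule ℝ V} {T : E2 →ₗ[ℝ] E2}
    {c : ℝ} (hc : 0 < c)
    (hT : ∀ X ∈ m, ∀ Z ∈ m, ∀ Y ∈ p, ∀ W ∈ p,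
      ⟪T (M.wedge2 X Y), M.wedge2 Z W⟫_ℝ = c * ⟪M.wedge2 X Y, M.wedge2 Z W⟫_ℝ)
    {σ : E2} (hσ : σ ∈ Submodule.span ℝ {σ : E2 | ∃ X Y : V, X ∈ m ∧ Y ∈ p ∧ σ = M.wedge2 X Y})
    (hσ0 : σ ≠ 0) : 0 < ⟪T σ, σ⟫_ℝ := by
  have key : ⟪T σ, σ⟫_ℝ = c * ⟪σ, σ⟫_ℝ := by
    refine Submodule.span_induction₂ (p := fun σ ρ _ _ => ⟪T σ, ρ⟫_ℝ = c * ⟪σ, ρ⟫_ℝ)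
      ?_ ?_ ?_ ?_ ?_ ?_ ?_ hσ hσ
    · rintro _ _ ⟨X, Y, hX, hY, rfl⟩ ⟨Z, W, hZ, hW, rfl⟩
      exact hT X hX Z hZ Y hY W hW
    · simp
    · simp
    · intro x y z _ _ _ h₁ h₂
      rw [map_add, inner_add_left, inner_add_left, h₁, h₂, mul_add]
    · intro x y z _ _ _ h₁ h₂
      rw [inner_add_right, inner_add_right, h₁, h₂, mul_add]
    · intro r x y _ _ h
      rw [map_smul, real_inner_smul_left, real_inner_smul_left, h, mul_left_comm]
    · intro r x y _ _ h
      rw [real_inner_smul_right, real_inner_smul_right, h, mul_left_comm]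
  rw [key]
  exact mul_pos hc (real_inner_self_pos.2 hσ0)

end ExtModel

open Matrix Quaternion in
/-- Strong fatness for the Wallach flag manifold
`W¹² = Sp(3)/Sp(1)Sp(1)Sp(1)`. Here `g` is (isomorphic, via `φ`, to) the Lie
algebra `sp(3)` of quaternionic `3×3` matrices `X` with `X* = −X`, with inner
product `Q(X,Y) = −Re tr(XY)` and bracket `[X,Y] = XY − YX`; `K` corresponds
to the block-diagonal subalgebra `{diag(A, q) : A ∈ sp(2), q ∈ sp(1)}` and
`H ⊆ K` to `{diag(q₁,q₂,q₃) : qᵢ ∈ Im ℍ}`; `m = Kᗮ` and `p = Hᗮ ⊓ K` are the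
`Q`-orthogonal complements of `K` in `g` and of `H` in `K`. Conclusion: there
exists `τ ∈ Λ²m⊗Λ²p` such that `F + τ` restricted to `m⊗p` is
positive-definite, where `⟪F(X∧Y), Z∧W⟫ = ⟪[X,Y],[Z,W]⟫` for `X,Z ∈ m`,
`Y,W ∈ p`. -/
theorem strong_fatness_W12
    {g : Type*} [NormedAddCommGroup g] [InnerProductSpace ℝ g] [FiniteDimensional ℝ g]
    (br : g →ₗ[ℝ] g →ₗ[ℝ] g)
    (φ : g →ₗ[ℝ] Matrix (Fin 3) (Fin 3) (Quaternion ℝ))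
    (hφ_inj : Function.Injective φ)
    (hφ_range : ∀ A : Matrix (Fin 3) (Fin 3) (Quaternion ℝ),
      (∃ X : g, φ X = A) ↔ Aᴴ = -A)
    (hφ_br : ∀ X Y : g, φ (br X Y) = φ X * φ Y - φ Y * φ X)
    (hQ : ∀ X Y : g, ⟪X, Y⟫_ℝ = -(Matrix.trace (φ X * φ Y)).re)
    (K H : Submodule ℝ g)
    (hK : ∀ X : g, X ∈ K ↔
      ((φ X) 0 2 = 0 ∧ (φ X) 1 2 = 0 ∧ (φ X) 2 0 = 0 ∧ (φ X) 2 1 = 0))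
    (hH : ∀ X : g, X ∈ H ↔
      ((∀ i j : Fin 3, i ≠ j → (φ X) i j = 0) ∧ (∀ i : Fin 3, ((φ X) i i).re = 0)))
    {E2 E4 : Type*}
    [NormedAddCommGroup E2] [InnerProductSpace ℝ E2] [FiniteDimensional ℝ E2]
    [NormedAddCommGroup E4] [InnerProductSpace ℝ E4] [FiniteDimensional ℝ E4]
    (M : ExtModel g E2 E4)
    (F : E2 →ₗ[ℝ] E2)
    (hF : ∀ X Z : g, X ∈ Kᗮ → Z ∈ Kᗮ → ∀ Y W : g, Y ∈ Hᗮ ⊓ K → W ∈ Hᗮ ⊓ K →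
      ⟪F (M.wedge2 X Y), M.wedge2 Z W⟫_ℝ = ⟪br X Y, br Z W⟫_ℝ) :
    ∃ τ ∈ Submodule.span ℝ
        {ω : E4 | ∃ X Y Z W : g, X ∈ Kᗮ ∧ Y ∈ Kᗮ ∧ Z ∈ Hᗮ ⊓ K ∧ W ∈ Hᗮ ⊓ K ∧
          ω = M.wedge4 X Y Z W},
      ∀ σ ∈ Submodule.span ℝ
          {σ : E2 | ∃ X Y : g, X ∈ Kᗮ ∧ Y ∈ Hᗮ ⊓ K ∧ σ = M.wedge2 X Y},
        σ ≠ 0 → 0 < ⟪(F + M.toOp τ) σ, σ⟫_ℝ := by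
  have skew : ∀ X : g, (φ X)ᴴ = -φ X := fun X => (hφ_range _).1 ⟨X, rfl⟩
  have hm : ∀ X ∈ Kᗮ, ∃ x y, φ X = lastColumnMatrix x y := by
    intro X hX
    have hs : ∀ i j, star (φ X j i) = -φ X i j := fun i j => congrFun (congrFun (skew X) i) j
    obtain ⟨B, hB⟩ := (hφ_range
      !![φ X 0 0, φ X 0 1, 0; φ X 1 0, φ X 1 1, 0; 0, 0, φ X 2 2]).2 (by
        ext i j : 1
        fin_cases i <;> fin_cases j <;> simp [hs])
    refine ⟨_, _, eq_lastColumnMatrix_of_trace_eq_zero (skew X) ?_⟩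
    rw [← hB, ← hQ]
    exact Submodule.inner_right_of_mem_orthogonal ((hK B).2 (by simp [hB])) hX
  have hp : ∀ Y ∈ Hᗮ ⊓ K, ∃ z, φ Y = upperLeftMatrix z := by
    intro Y hY
    have hs : ∀ i j, star (φ Y j i) = -φ Y i j := fun i j => congrFun (congrFun (skew Y) i) j
    have hre : ∀ i, (φ Y i i).re = 0 := fun i => by
      have := congrArg (fun q : ℍ[ℝ] => q.re) (hs i i)
      simp only [Quaternion.re_star, Quaternion.re_neg] at this
      linarith
    obtain ⟨B, hB⟩ := (hφ_range !![φ Y 0 0, 0, 0; 0, φ Y 1 1, 0; 0, 0, φ Y 2 2]).2 (by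
        ext i j : 1
        fin_cases i <;> fin_cases j <;> simp [hs])
    refine ⟨_, eq_upperLeftMatrix_of_trace_eq_zero (skew Y) ((hK Y).1 hY.2) ?_⟩
    rw [← hB, ← hQ]
    refine Submodule.inner_right_of_mem_orthogonal ((hH B).2 ⟨?_, ?_⟩) hY.1
    · intro i j hij
      rw [hB]
      fin_cases i <;> fin_cases j <;> simp at hij ⊢
    · intro i
      rw [hB]
      fin_cases i <;> simp [hre]
  choose u hu using fun x y => (hφ_range _).2 (lastColumnMatrix_conjTranspose x y)
  choose v hv using fun z => (hφ_range _).2 (upperLeftMatrix_conjTranspose z)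
  have hu_mem : ∀ x y, u x y ∈ Kᗮ := by
    intro x y
    rw [Submodule.mem_orthogonal]
    intro B hB
    obtain ⟨h₁, h₂, h₃, h₄⟩ := (hK B).1 hB
    simp [hQ, hu, lastColumnMatrix, Matrix.trace_fin_three, Matrix.mul_apply, Fin.sum_univ_three,
      h₁, h₂, h₃, h₄]
  have hv_mem : ∀ z, v z ∈ Hᗮ ⊓ K := by
    refine fun z => ⟨?_, (hK _).2 (by simp [hv, upperLeftMatrix])⟩
    rw [SetLike.mem_coe, Submodule.mem_orthogonal]
    intro B hB
    obtain ⟨h, -⟩ := (hH B).1 hB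
    simp [hQ, hv, upperLeftMatrix, Matrix.trace_fin_three, Matrix.mul_apply, Fin.sum_univ_three,
      h 0 1 (by decide), h 1 0 (by decide)]
  have hmp : ∀ X ∈ Kᗮ, ∀ Y ∈ Hᗮ ⊓ K, ⟪X, Y⟫_ℝ = 0 := fun X hX Y hY =>
    Submodule.inner_left_of_mem_orthogonal hY.2 hX
  have hpm : ∀ X ∈ Kᗮ, ∀ Y ∈ Hᗮ ⊓ K, ⟪Y, X⟫_ℝ = 0 := fun X hX Y hY =>
    Submodule.inner_right_of_mem_orthogonal hY.2 hX
  refine ⟨(1 / 8 : ℝ) •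
      (M.selfDualWedge (fun i => u (quaternionUnit i) 0) (fun i => v (quaternionUnit i)) +
        M.selfDualWedge (fun i => u 0 (quaternionUnit i)) (fun i => v (star (quaternionUnit i)))),
    Submodule.smul_mem _ _ (Submodule.add_mem _
      (M.selfDualWedge_mem_span (fun _ => hu_mem _ _) (fun _ => hv_mem _))
      (M.selfDualWedge_mem_span (fun _ => hu_mem _ _) (fun _ => hv_mem _))), fun σ hσ hσ0 => ?_⟩
  refine M.inner_pos_of_forall_wedge2 (c := 1 / 2) (by norm_num) ?_ hσ hσ0
  intro X hX Z hZ Y hY W hW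
  rw [LinearMap.add_apply, inner_add_left, hF X Z hX hZ Y W hY hW, M.toOp_spec,
    real_inner_smul_left, inner_add_left,
    M.inner_selfDualWedge (fun _ => hmp _ (hu_mem _ _) Y hY) (fun _ => hmp _ (hu_mem _ _) W hW)
      (fun _ => hpm X hX _ (hv_mem _)) (fun _ => hpm Z hZ _ (hv_mem _)),
    M.inner_selfDualWedge (fun _ => hmp _ (hu_mem _ _) Y hY) (fun _ => hmp _ (hu_mem _ _) W hW)
      (fun _ => hpm X hX _ (hv_mem _)) (fun _ => hpm Z hZ _ (hv_mem _)),
    M.inner_wedge2, hmp X hX W hW, hpm Z hZ Y hY]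
  obtain ⟨x, y, hx⟩ := hm X hX
  obtain ⟨x', y', hx'⟩ := hm Z hZ
  obtain ⟨z, hz⟩ := hp Y hY
  obtain ⟨w, hw⟩ := hp W hW
  simp only [hQ, hφ_br, hu, hv, hx, hx', hz, hw, trace_quaternionUnit_left,
    trace_quaternionUnit_right, trace_quaternionUnit_upper, trace_star_quaternionUnit_upper]
  simp only [lastColumnMatrix_bracket_upperLeftMatrix, trace_lastColumnMatrix_mul,
    trace_upperLeftMatrix_mul, Matrix.cons_val, Quaternion.re_star, Quaternion.imI_star,
    Quaternion.imJ_star, Quaternion.imK_star, Quaternion.re_neg, Quaternion.imI_neg,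
    Quaternion.imJ_neg, Quaternion.imK_neg, Quaternion.re_mul, Quaternion.imI_mul,
    Quaternion.imJ_mul, Quaternion.imK_mul]
  ring
end
end

section
/- The Berger space B⁷ = SO(5)/SO(3) has strongly positive curvature: let g = so(5) (real skew-symmetric 5×5 matrices) with inner product Q(X,Y) = −(1/10)tr(XY), let h ⊂ g be the image of so(3) under the Lie algebra homomorphism induced by the conjugation action of SO(3) on the 5-dimensional space of symmetric traceless real 3×3 matrices (the irreducible 5-dimensional representation), and let m be the Q-orthogonal complement of h in g, with X_h denoting the Q-orthogonal projection of X ∈ g onto h. Define the self-adjoint operator R̂ on Λ²m by ⟨R̂(X∧Y), Z∧W⟩ = (1/4)Q([X,Y],[Z,W]) + (3/4)Q([X,Y]_h, [Z,W]_h). Then there exists ω ∈ Λ⁴m such that R̂ + ω is positive-definite. -/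
/- Common setup: an abstract model of the second and fourth exterior powers
`Λ²V` and `Λ⁴V` of a real inner product space `V`, with the induced inner
products, the identification of 4-vectors with self-adjoint operators on
`Λ²V`, and the Bianchi map. -/

noncomputable section

open scoped InnerProductSpace

namespace ExtModel

variable {V E2 E4 : Type*} [NormedAddCommGroup V] [InnerProductSpace ℝ V]
  [NormedAddCommGroup E2] [InnerProductSpace ℝ E2]
  [NormedAddCommGroup E4] [InnerProductSpace ℝ E4]

/-- Every alternating 4-form is represented, via the inner product, by a 4-vector. -/
theorem exists_inner_wedge4_eq [FiniteDimensional ℝ V] (M : ExtModel V E2 E4)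
    (τ : V [⋀^Fin 4]→ₗ[ℝ] ℝ) :
    ∃ ω : E4, ∀ x : Fin 4 → V, ⟪ω, M.wedge4 (x 0) (x 1) (x 2) (x 3)⟫_ℝ = τ x := by
  let b := stdOrthonormalBasis ℝ V
  have hτ (x : Fin 4 → V) :
      ∑ v : Fin 4 → Fin (Module.finrank ℝ V), τ (fun j => b (v j)) * ∏ j, ⟪b (v j), x j⟫_ℝ
        = τ x := by
    have hx : x = fun j => ∑ i, ⟪b i, x j⟫_ℝ • b i := by
      funext j
      exact (b.sum_repr' (x j)).symm
    conv_rhs => rw [hx]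
    rw [← AlternatingMap.coe_multilinearMap, MultilinearMap.map_sum]
    refine Finset.sum_congr rfl fun v _ => ?_
    rw [MultilinearMap.map_smul_univ, smul_eq_mul, mul_comm]
  refine ⟨(1 / 24 : ℝ) • ∑ v : Fin 4 → Fin (Module.finrank ℝ V),
    τ (fun j => b (v j)) • M.wedge4 (b (v 0)) (b (v 1)) (b (v 2)) (b (v 3)), fun x => ?_⟩
  have hdet (v : Fin 4 → Fin (Module.finrank ℝ V)) :
      ⟪M.wedge4 (b (v 0)) (b (v 1)) (b (v 2)) (b (v 3)), M.wedge4 (x 0) (x 1) (x 2) (x 3)⟫_ℝ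
        = ∑ σ : Equiv.Perm (Fin 4), (Equiv.Perm.sign σ : ℝ) * ∏ j, ⟪b (v (σ j)), x j⟫_ℝ := by
    rw [M.inner_wedge4 (fun j => b (v j)) x, Matrix.det_apply']
    simp
  have hσ (σ : Equiv.Perm (Fin 4)) :
      ∑ v : Fin 4 → Fin (Module.finrank ℝ V),
        τ (fun j => b (v j)) * ((Equiv.Perm.sign σ : ℝ) * ∏ j, ⟪b (v (σ j)), x j⟫_ℝ) = τ x := by
    rw [← hτ x]
    refine Fintype.sum_equiv (Equiv.arrowCongr σ.symm (Equiv.refl _)) _ _ fun v => ?_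
    have h := τ.map_perm (fun j => b (v j)) σ
    simp only [Equiv.arrowCongr_apply, Equiv.symm_symm, Equiv.coe_refl, Function.comp_apply, id]
    have h' : (fun j => b (v (σ j))) = (fun j => b (v j)) ∘ σ := rfl
    rw [h', h, Units.smul_def, zsmul_eq_mul]
    ring
  rw [real_inner_smul_left, sum_inner]
  simp only [real_inner_smul_left, hdet, Finset.mul_sum]
  rw [Finset.sum_comm]
  simp only [← Finset.mul_sum, hσ]
  simp [Fintype.card_perm, Nat.factorial]

/-- If an operator on `Λ²V` agrees on decomposable bivectors with a positive multiple of the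
identity plus a pulled back inner product, then it is positive-definite. -/
theorem isPosDef_of_inner_wedge2 {F : Type*} [NormedAddCommGroup F] [InnerProductSpace ℝ F]
    (M : ExtModel V E2 E4) (T : E2 →ₗ[ℝ] E2) (f : V → V → F) {a : ℝ} (ha : 0 < a)
    (hT : ∀ X Y Z W : V, ⟪T (M.wedge2 X Y), M.wedge2 Z W⟫_ℝ
      = a * ⟪M.wedge2 X Y, M.wedge2 Z W⟫_ℝ + ⟪f X Y, f Z W⟫_ℝ) :
    IsPosDef T := by
  intro v hv
  have hmem : v ∈ Submodule.span ℝ {σ : E2 | ∃ X Y : V, σ = M.wedge2 X Y} := by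
    rw [M.span_wedge2]
    trivial
  obtain ⟨n, c, s, rfl⟩ := Submodule.mem_span_set'.1 hmem
  choose X Y hXY using fun i => (s i).2
  simp only [hXY] at hv ⊢
  have key : ⟪T (∑ i, c i • M.wedge2 (X i) (Y i)), ∑ i, c i • M.wedge2 (X i) (Y i)⟫_ℝ
      = a * ⟪∑ i, c i • M.wedge2 (X i) (Y i), ∑ i, c i • M.wedge2 (X i) (Y i)⟫_ℝ
        + ⟪∑ i, c i • f (X i) (Y i), ∑ i, c i • f (X i) (Y i)⟫_ℝ := by
    simp only [map_sum, map_smul, sum_inner, inner_sum, real_inner_smul_left,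
      real_inner_smul_right, hT, Finset.mul_sum, ← Finset.sum_add_distrib]
    refine Finset.sum_congr rfl fun i _ => Finset.sum_congr rfl fun j _ => ?_
    ring
  rw [key]
  have h1 := real_inner_self_pos.2 hv
  have h2 := real_inner_self_nonneg (x := ∑ i, c i • f (X i) (Y i))
  positivity

end ExtModel

/-- The alternating 4-form `⟪X ∧ Y, Z ∧ W⟫ - ⟪m X Y, m Z W⟫ + ⟪h X Y, h Z W⟫` of two alternating
products `m` and `h` for which it vanishes on `(X, Y, X, Y)`. -/
def crossProductForm {V F : Type*} [NormedAddCommGroup V] [InnerProductSpace ℝ V]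
    [NormedAddCommGroup F] [InnerProductSpace ℝ F] (m h : V →ₗ[ℝ] V →ₗ[ℝ] F)
    (hm : ∀ X, m X X = 0) (hh : ∀ X, h X X = 0)
    (hmh : ∀ X Y, ⟪X, X⟫_ℝ * ⟪Y, Y⟫_ℝ - ⟪X, Y⟫_ℝ * ⟪Y, X⟫_ℝ
      - ⟪m X Y, m X Y⟫_ℝ + ⟪h X Y, h X Y⟫_ℝ = 0) : V [⋀^Fin 4]→ₗ[ℝ] ℝ where
  toFun x := ⟪x 0, x 2⟫_ℝ * ⟪x 1, x 3⟫_ℝ - ⟪x 0, x 3⟫_ℝ * ⟪x 1, x 2⟫_ℝ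
    - ⟪m (x 0) (x 1), m (x 2) (x 3)⟫_ℝ + ⟪h (x 0) (x 1), h (x 2) (x 3)⟫_ℝ
  map_update_add' := @fun inst x i X Y => by
    obtain rfl : inst = instDecidableEqFin 4 := Subsingleton.elim _ _
    fin_cases i <;>
      simp [Function.update, inner_add_left, inner_add_right] <;> ring
  map_update_smul' := @fun inst x i c X => by
    obtain rfl : inst = instDecidableEqFin 4 := Subsingleton.elim _ _
    fin_cases i <;>
      simp [Function.update, real_inner_smul_left, real_inner_smul_right] <;> ring
  map_eq_zero_of_eq' x i j hij hne := by
    have swap (k : V →ₗ[ℝ] V →ₗ[ℝ] F) (hk : ∀ X, k X X = 0) (X Y : V) : k X Y = -k Y X := by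
      have := hk (X + Y)
      simp only [map_add, LinearMap.add_apply, hk, zero_add, add_zero] at this
      exact eq_neg_of_add_eq_zero_right this
    have polar (X Y W : V) : ⟪X, X⟫_ℝ * ⟪Y, W⟫_ℝ - ⟪X, W⟫_ℝ * ⟪Y, X⟫_ℝ
        - ⟪m X Y, m X W⟫_ℝ + ⟪h X Y, h X W⟫_ℝ = 0 := by
      have e1 := hmh X (Y + W)
      have e2 := hmh X Y
      have e3 := hmh X W
      simp only [map_add, inner_add_left, inner_add_right] at e1
      rw [real_inner_comm Y W, real_inner_comm (m X Y) (m X W),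
        real_inner_comm (h X Y) (h X W)] at e1
      rw [real_inner_comm X Y, real_inner_comm X W] at *
      linarith
    have swapm := swap m hm
    have swaph := swap h hh
    have p02 := polar (x 0) (x 1) (x 3)
    have p03 := polar (x 0) (x 1) (x 2)
    have p12 := polar (x 1) (x 0) (x 3)
    have p13 := polar (x 1) (x 0) (x 2)
    wlog hlt : i < j generalizing i j
    · exact this j i hij.symm hne.symm (lt_of_le_of_ne (not_lt.1 hlt) hne.symm)
    fin_cases i <;> fin_cases j <;> simp at hlt hij ⊢
    · simp [hij, hm, hh]; ring
    · rw [← hij]; linarith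
    · rw [← hij, swapm (x 2), swaph (x 2), inner_neg_right, inner_neg_right]; linarith
    · rw [← hij, swapm (x 0), swaph (x 0), inner_neg_left, inner_neg_left]; linarith
    · rw [← hij, swapm (x 0), swaph (x 0), swapm (x 2), swaph (x 2), inner_neg_left,
        inner_neg_right, inner_neg_left, inner_neg_right]
      linarith
    · simp [hij, hm, hh]

section IsotropyRepresentation

open Matrix

/-- An orthogonal basis of the symmetric traceless real `3×3` matrices. -/
def symTracelessBasis : Fin 5 → Matrix (Fin 3) (Fin 3) ℝ :=
  ![!![1, 0, 0; 0, -1, 0; 0, 0, 0], !![1, 0, 0; 0, 1, 0; 0, 0, -2],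
    !![0, 1, 0; 1, 0, 0; 0, 0, 0], !![0, 0, 1; 0, 0, 0; 1, 0, 0],
    !![0, 0, 0; 0, 0, 1; 0, 1, 0]]

/-- The squared norms of the elements of `symTracelessBasis`. -/
def symTracelessNormSq : Fin 5 → ℝ := ![2, 6, 2, 2, 2]

/-- The inverse Gram matrix of `symTracelessBasis`. -/
def gramInv : Matrix (Fin 5) (Fin 5) ℝ := diagonal fun i => (symTracelessNormSq i)⁻¹

/-- The standard basis of `so(3)`. -/
def soThreeBasis : Fin 3 → Matrix (Fin 3) (Fin 3) ℝ :=
  ![!![0, 1, 0; -1, 0, 0; 0, 0, 0], !![0, 0, 1; 0, 0, 0; -1, 0, 0],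
    !![0, 0, 0; 0, 0, 1; 0, -1, 0]]

/-- The matrices `⟪E i, [L k, E j]⟫` of the action of `so(3)` on symmetric traceless matrices. -/
def soThreeAction : Fin 3 → Matrix (Fin 5) (Fin 5) ℝ :=
  ![!![0, 0, 4, 0, 0; 0, 0, 0, 0, 0; -4, 0, 0, 0, 0; 0, 0, 0, 0, 2; 0, 0, 0, -2, 0],
    !![0, 0, 0, 2, 0; 0, 0, 0, 6, 0; 0, 0, 0, 0, 2; -2, -6, 0, 0, 0; 0, 0, -2, 0, 0],
    !![0, 0, 0, 0, -2; 0, 0, 0, 0, 6; 0, 0, 0, 2, 0; 0, 0, -2, 0, 0; 2, -6, 0, 0, 0]]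

/-- The inner product of `so(5)` in the coordinates given by `symTracelessBasis`. -/
def soFiveForm (a b : Matrix (Fin 5) (Fin 5) ℝ) : ℝ :=
  -(1 / 10) * trace (gramInv * a * gramInv * b)

theorem trace_symTracelessBasis (i j : Fin 5) :
    trace (symTracelessBasis i * symTracelessBasis j)
      = diagonal symTracelessNormSq i j := by
  fin_cases i <;> fin_cases j <;>
    simp [symTracelessBasis, symTracelessNormSq, trace, Fin.sum_univ_three] <;>
    norm_num

theorem symTracelessBasis_mem (i : Fin 5) :
    (symTracelessBasis i)ᵀ = symTracelessBasis i ∧ trace (symTracelessBasis i) = 0 := by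
  constructor
  · ext k l
    fin_cases i <;> fin_cases k <;> fin_cases l <;> simp [symTracelessBasis]
  · fin_cases i <;> simp [symTracelessBasis, trace, Fin.sum_univ_three]
    norm_num

theorem trace_soThreeBasis_action (k : Fin 3) (i j : Fin 5) :
    trace (symTracelessBasis i * (soThreeBasis k * symTracelessBasis j
      - symTracelessBasis j * soThreeBasis k)) = soThreeAction k i j := by
  fin_cases k <;> fin_cases i <;> fin_cases j <;>
    simp [symTracelessBasis, soThreeBasis, soThreeAction, trace, Fin.sum_univ_three] <;>
    norm_num

theorem soThreeBasis_transpose (k : Fin 3) : (soThreeBasis k)ᵀ = -soThreeBasis k := by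
  ext i j
  fin_cases k <;> fin_cases i <;> fin_cases j <;> simp [soThreeBasis]

theorem exists_eq_sum_soThreeBasis {A : Matrix (Fin 3) (Fin 3) ℝ} (hA : Aᵀ = -A) :
    ∃ c : Fin 3 → ℝ, A = ∑ k, c k • soThreeBasis k := by
  refine ⟨![A 0 1, A 0 2, A 1 2], ?_⟩
  have h (i j : Fin 3) : A j i = -A i j := congrFun (congrFun hA i) j
  ext i j
  have h00 := h 0 0
  have h11 := h 1 1
  have h22 := h 2 2
  have h01 := h 0 1
  have h02 := h 0 2
  have h12 := h 1 2
  fin_cases i <;> fin_cases j <;>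
    simp [soThreeBasis, Fin.sum_univ_three] <;> linarith

theorem soFiveForm_apply (a b : Matrix (Fin 5) (Fin 5) ℝ) :
    soFiveForm a b = -(1 / 10) * ∑ i, ∑ j,
      (symTracelessNormSq i)⁻¹ * a i j * (symTracelessNormSq j)⁻¹ * b j i := by
  simp [soFiveForm, gramInv, trace, Matrix.mul_apply, Matrix.diagonal_apply]

theorem soFiveForm_soThreeAction (k l : Fin 3) :
    soFiveForm (soThreeAction k) (soThreeAction l) = if k = l then 1 else 0 := by
  rw [soFiveForm_apply]
  fin_cases k <;> fin_cases l <;>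
    simp [soThreeAction, symTracelessNormSq, Fin.sum_univ_five] <;> norm_num

theorem eq_isotropyComplement {a : Matrix (Fin 5) (Fin 5) ℝ} (ha : aᵀ = -a)
    (h : ∀ k, soFiveForm a (soThreeAction k) = 0) :
    ∃ p q r s t u v : ℝ, a = !![0, p, q, r, s; -p, 0, t, u, v; -q, -t, 0, s - v, -r - u;
      -r, -u, v - s, 0, -2 * q; -s, -v, r + u, 2 * q, 0] := by
  have ha' (i j : Fin 5) : a j i = -a i j := congrFun (congrFun ha i) j
  have d0 := ha' 0 0
  have d1 := ha' 1 1
  have d2 := ha' 2 2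
  have d3 := ha' 3 3
  have d4 := ha' 4 4
  have h0 := h 0
  have h1 := h 1
  have h2 := h 2
  simp [soFiveForm_apply, soThreeAction, symTracelessNormSq, Fin.sum_univ_five,
    ha' 0 1, ha' 0 2, ha' 0 3, ha' 0 4, ha' 1 2, ha' 1 3, ha' 1 4, ha' 2 3, ha' 2 4,
    ha' 3 4] at h0 h1 h2
  refine ⟨a 0 1, a 0 2, a 0 3, a 0 4, a 1 2, a 1 3, a 1 4, ?_⟩
  ext i j
  fin_cases i <;> fin_cases j <;> simp [ha' 0 1, ha' 0 2, ha' 0 3, ha' 0 4, ha' 1 2, ha' 1 3,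
    ha' 1 4, ha' 2 3, ha' 2 4, ha' 3 4] <;> linarith

theorem soFiveForm_of_skew {a b : Matrix (Fin 5) (Fin 5) ℝ} (ha : aᵀ = -a) (hb : bᵀ = -b) :
    soFiveForm a b = 1 / 60 * (a 0 1 * b 0 1 + 3 * a 0 2 * b 0 2 + 3 * a 0 3 * b 0 3
      + 3 * a 0 4 * b 0 4 + a 1 2 * b 1 2 + a 1 3 * b 1 3 + a 1 4 * b 1 4
      + 3 * a 2 3 * b 2 3 + 3 * a 2 4 * b 2 4 + 3 * a 3 4 * b 3 4) := by
  have ha' (i j : Fin 5) : a j i = -a i j := congrFun (congrFun ha i) j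
  have hb' (i j : Fin 5) : b j i = -b i j := congrFun (congrFun hb i) j
  have d (i : Fin 5) : a i i = 0 := by linarith [ha' i i]
  simp only [soFiveForm_apply, symTracelessNormSq, Fin.sum_univ_five, d, ha' 0 1, ha' 0 2,
    ha' 0 3, ha' 0 4, ha' 1 2, ha' 1 3, ha' 1 4, ha' 2 3, ha' 2 4, ha' 3 4, hb' 0 1, hb' 0 2,
    hb' 0 3, hb' 0 4, hb' 1 2, hb' 1 3, hb' 1 4, hb' 2 3, hb' 2 4, hb' 3 4]
  simp
  ring

theorem soThreeAction_transpose (k : Fin 3) : (soThreeAction k)ᵀ = -soThreeAction k := by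
  ext i j
  fin_cases k <;> fin_cases i <;> fin_cases j <;> simp [soThreeAction]

theorem gramInv_bracket_apply (a b : Matrix (Fin 5) (Fin 5) ℝ) (i j : Fin 5) :
    (a * gramInv * b - b * gramInv * a) i j
      = (a i 0 * b 0 j - b i 0 * a 0 j) / 2 + (a i 1 * b 1 j - b i 1 * a 1 j) / 6
        + (a i 2 * b 2 j - b i 2 * a 2 j) / 2 + (a i 3 * b 3 j - b i 3 * a 3 j) / 2
        + (a i 4 * b 4 j - b i 4 * a 4 j) / 2 := by
  simp [gramInv, symTracelessNormSq, Fin.sum_univ_five, Matrix.mul_apply, Matrix.diagonal_apply]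
  ring

/-- The `m`-component of the bracket on the isotropy representation of the Berger space is a
cross product. -/
theorem soFiveForm_bracket {a b : Matrix (Fin 5) (Fin 5) ℝ} (ha : aᵀ = -a) (hb : bᵀ = -b)
    (ha' : ∀ k, soFiveForm a (soThreeAction k) = 0)
    (hb' : ∀ k, soFiveForm b (soThreeAction k) = 0)
    {c : Matrix (Fin 5) (Fin 5) ℝ} (hc : c = a * gramInv * b - b * gramInv * a) :
    soFiveForm a a * soFiveForm b b - soFiveForm a b ^ 2
      = soFiveForm c c - ∑ k, soFiveForm c (soThreeAction k) ^ 2 := by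
  have hg : gramInvᵀ = gramInv := diagonal_transpose _
  have hcs : cᵀ = -c := by
    rw [hc, transpose_sub, transpose_mul, transpose_mul, transpose_mul, transpose_mul, ha, hb, hg]
    noncomm_ring
  have hc' (i j : Fin 5) :=
    (congrFun (congrFun hc i) j).trans (gramInv_bracket_apply a b i j)
  rw [soFiveForm_of_skew ha ha, soFiveForm_of_skew hb hb, soFiveForm_of_skew ha hb,
    soFiveForm_of_skew hcs hcs, Fin.sum_univ_three,
    soFiveForm_of_skew hcs (soThreeAction_transpose 0),
    soFiveForm_of_skew hcs (soThreeAction_transpose 1),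
    soFiveForm_of_skew hcs (soThreeAction_transpose 2)]
  obtain ⟨p, q, r, s, t, u, v, rfl⟩ := eq_isotropyComplement ha ha'
  obtain ⟨p', q', r', s', t', u', v', rfl⟩ := eq_isotropyComplement hb hb'
  simp only [hc']
  simp [soThreeAction]
  ring

/-- An isometry onto the symmetric traceless matrices gives coordinates `U` on `ℝ⁵` adapted to
`symTracelessBasis`. -/
theorem exists_adapted_coordinates
    (e : (Fin 5 → ℝ) →ₗ[ℝ] Matrix (Fin 3) (Fin 3) ℝ)
    (he_range : Set.range e = {S : Matrix (Fin 3) (Fin 3) ℝ | Sᵀ = S ∧ trace S = 0})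
    (he_inner : ∀ u v : Fin 5 → ℝ, ∑ i, u i * v i = trace (e u * e v)) :
    ∃ U : Matrix (Fin 5) (Fin 5) ℝ, (∀ i, e (U i) = symTracelessBasis i) ∧
      Uᵀ * gramInv * U = 1 := by
  have hex (i : Fin 5) : ∃ f, e f = symTracelessBasis i := by
    have : symTracelessBasis i ∈ Set.range e := by
      rw [he_range]
      exact symTracelessBasis_mem i
    exact this
  choose f hf using hex
  refine ⟨Matrix.of f, hf, ?_⟩
  have h1 : Matrix.of f * (Matrix.of f)ᵀ = diagonal symTracelessNormSq := by
    ext i j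
    rw [← trace_symTracelessBasis, ← hf, ← hf, ← he_inner]
    rfl
  have h2 : Matrix.of f * ((Matrix.of f)ᵀ * gramInv) = 1 := by
    rw [← mul_assoc, h1, gramInv, diagonal_mul_diagonal, ← diagonal_one]
    congr 1
    funext i
    fin_cases i <;> simp [symTracelessNormSq]
  exact mul_eq_one_comm.1 h2

/-- The action of `so(3)` on symmetric traceless matrices is by skew-symmetric operators. -/
theorem exists_skew_mulVec_eq_commutator
    (e : (Fin 5 → ℝ) →ₗ[ℝ] Matrix (Fin 3) (Fin 3) ℝ)
    (he_range : Set.range e = {S : Matrix (Fin 3) (Fin 3) ℝ | Sᵀ = S ∧ trace S = 0})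
    (he_inner : ∀ u v : Fin 5 → ℝ, ∑ i, u i * v i = trace (e u * e v))
    {A : Matrix (Fin 3) (Fin 3) ℝ} (hA : Aᵀ = -A) :
    ∃ N : Matrix (Fin 5) (Fin 5) ℝ, Nᵀ = -N ∧ ∀ v, e (N *ᵥ v) = A * e v - e v * A := by
  have hex (j : Fin 5) : ∃ w, e w = A * e (Pi.single j 1) - e (Pi.single j 1) * A := by
    have hj : e (Pi.single j 1) ∈ Set.range e := ⟨_, rfl⟩
    have : A * e (Pi.single j 1) - e (Pi.single j 1) * A ∈ Set.range e := by
      rw [he_range] at hj ⊢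
      refine ⟨?_, ?_⟩
      · rw [transpose_sub, transpose_mul, transpose_mul, hj.1, hA]
        noncomm_ring
      · rw [trace_sub, trace_mul_comm, sub_self]
    exact this
  choose w hw using hex
  refine ⟨Matrix.of fun i j => w j i, ?_, fun v => ?_⟩
  · ext i j
    have h1 (i j : Fin 5) : w j i = trace (e (Pi.single i 1) * e (w j)) := by
      rw [← he_inner]
      simp [Pi.single_apply]
    change w i j = -w j i
    rw [h1 j i, h1 i j, hw, hw, mul_sub, mul_sub, trace_sub, trace_sub]
    simp only [← mul_assoc]
    rw [trace_mul_cycle (e (Pi.single j 1)) A, trace_mul_cycle (e (Pi.single i 1)) A]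
    ring
  · have hN : (Matrix.of fun i j => w j i) *ᵥ v = ∑ j, v j • w j := by
      ext i
      simp [mulVec, dotProduct, mul_comm]
    have hv : e v = ∑ j, v j • e (Pi.single j 1) := by
      conv_lhs => rw [pi_eq_sum_univ' v]
      simp [map_sum, map_smul]
    rw [hN, hv, map_sum, Finset.mul_sum, Finset.sum_mul, ← Finset.sum_sub_distrib]
    refine Finset.sum_congr rfl fun j _ => ?_
    rw [map_smul, hw, mul_smul_comm, smul_mul_assoc, smul_sub]

end IsotropyRepresentation

/-- The squared norm of the orthogonal projection onto a subspace spanned by an orthonormal family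
is the sum of the squared coefficients. -/
theorem inner_projection_self_eq_sum {g ι : Type*} [NormedAddCommGroup g] [InnerProductSpace ℝ g]
    [Fintype ι] [DecidableEq ι] {H : Submodule ℝ g} {h : ι → g} (hmem : ∀ k, h k ∈ H)
    (horth : ∀ k l, ⟪h k, h l⟫_ℝ = if k = l then 1 else 0)
    (hspan : ∀ X ∈ H, ∃ c : ι → ℝ, X = ∑ k, c k • h k)
    {X Y : g} (hY : Y ∈ H) (hXY : X - Y ∈ Hᗮ) :
    ⟪Y, Y⟫_ℝ = ∑ k, ⟪X, h k⟫_ℝ ^ 2 := by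
  obtain ⟨c, rfl⟩ := hspan Y hY
  have hk (k : ι) : ⟪X, h k⟫_ℝ = c k := by
    have h0 := Submodule.inner_left_of_mem_orthogonal (hmem k) hXY
    rw [inner_sub_left, sub_eq_zero] at h0
    rw [h0]
    simp [sum_inner, real_inner_smul_left, horth]
  simp only [hk, sum_inner, inner_sum, real_inner_smul_left, real_inner_smul_right, horth]
  simp [sq]

open Matrix in
/-- The Berger space `B⁷ = SO(5)/SO(3)` has strongly
positive curvature. Here `g` is (isomorphic, via `φ`, to) the Lie algebra
`so(5)` of real skew-symmetric `5×5` matrices, with inner product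
`Q(X,Y) = −(1/10) tr(XY)` and bracket `[X,Y] = XY − YX`. The map `e`
identifies `ℝ⁵` (with its dot product) isometrically with the 5-dimensional
space of symmetric traceless real `3×3` matrices (with the trace form
`tr(ST)`), and `H ⊆ g` is the image of `so(3)` under the induced Lie algebra
homomorphism: `X ∈ H` iff the operator `φ X` corresponds under `e` to
`S ↦ AS − SA` for some skew-symmetric `A` (the conjugation action of `SO(3)`
on the irreducible 5-dimensional representation). `m = Hᗮ` is the
`Q`-orthogonal complement and `P X = X_h` the `Q`-orthogonal projection onto
`H`. Let `R̂` be the self-adjoint operator on `Λ²m` defined by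
`⟪R̂(X∧Y), Z∧W⟫ = (1/4) Q([X,Y],[Z,W]) + (3/4) Q([X,Y]_h, [Z,W]_h)`. Then
there exists `ω ∈ Λ⁴m` such that `R̂ + ω` is positive-definite. -/
theorem berger_B7_strongly_positive
    {g : Type*} [NormedAddCommGroup g] [InnerProductSpace ℝ g] [FiniteDimensional ℝ g]
    (br : g →ₗ[ℝ] g →ₗ[ℝ] g)
    (φ : g →ₗ[ℝ] Matrix (Fin 5) (Fin 5) ℝ)
    (hφ_inj : Function.Injective φ)
    (hφ_range : ∀ A : Matrix (Fin 5) (Fin 5) ℝ, (∃ X : g, φ X = A) ↔ Aᵀ = -A)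
    (hφ_br : ∀ X Y : g, φ (br X Y) = φ X * φ Y - φ Y * φ X)
    (hQ : ∀ X Y : g, ⟪X, Y⟫_ℝ = -(1 / 10) * Matrix.trace (φ X * φ Y))
    (e : (Fin 5 → ℝ) →ₗ[ℝ] Matrix (Fin 3) (Fin 3) ℝ)
    (he_inj : Function.Injective e)
    (he_range : Set.range e = {S : Matrix (Fin 3) (Fin 3) ℝ | Sᵀ = S ∧ Matrix.trace S = 0})
    (he_inner : ∀ u v : Fin 5 → ℝ, ∑ i, u i * v i = Matrix.trace (e u * e v))
    (H : Submodule ℝ g)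
    (hH : ∀ X : g, X ∈ H ↔ ∃ A : Matrix (Fin 3) (Fin 3) ℝ, Aᵀ = -A ∧
      ∀ v : Fin 5 → ℝ, e ((φ X).mulVec v) = A * e v - e v * A)
    (P : g →ₗ[ℝ] g)
    (hP_mem : ∀ X : g, P X ∈ H)
    (hP_perp : ∀ X : g, X - P X ∈ Hᗮ)
    {E2 E4 : Type*}
    [NormedAddCommGroup E2] [InnerProductSpace ℝ E2] [FiniteDimensional ℝ E2]
    [NormedAddCommGroup E4] [InnerProductSpace ℝ E4] [FiniteDimensional ℝ E4]
    (M : ExtModel (↥Hᗮ) E2 E4)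
    (Rhat : E2 →ₗ[ℝ] E2) (hRhat_sym : Rhat.IsSymmetric)
    (hRhat : ∀ X Y Z W : ↥Hᗮ,
      ⟪Rhat (M.wedge2 X Y), M.wedge2 Z W⟫_ℝ
        = (1 / 4) * ⟪br (X : g) (Y : g), br (Z : g) (W : g)⟫_ℝ
          + (3 / 4) * ⟪P (br (X : g) (Y : g)), P (br (Z : g) (W : g))⟫_ℝ) :
    ∃ ω : E4, IsPosDef (Rhat + M.toOp ω) := by
  obtain ⟨U, hUe, hU⟩ := exists_adapted_coordinates e he_range he_inner
  let ψ (X : g) : Matrix (Fin 5) (Fin 5) ℝ := U * φ X * Uᵀ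
  have hψ_mul (X Y : g) : ψ X * gramInv * ψ Y = U * (φ X * φ Y) * Uᵀ := by
    calc ψ X * gramInv * ψ Y = U * φ X * (Uᵀ * gramInv * U) * φ Y * Uᵀ := by
          simp only [ψ, mul_assoc]
      _ = U * (φ X * φ Y) * Uᵀ := by rw [hU, mul_one]; simp only [mul_assoc]
  have hψ_skew (X : g) : (ψ X)ᵀ = -ψ X := by
    have hX : (φ X)ᵀ = -φ X := (hφ_range _).1 ⟨X, rfl⟩
    simp only [ψ, transpose_mul, transpose_transpose, hX, mul_neg, neg_mul, mul_assoc]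
  have hψ_br (X Y : g) : ψ (br X Y) = ψ X * gramInv * ψ Y - ψ Y * gramInv * ψ X := by
    rw [hψ_mul, hψ_mul]
    simp only [ψ, hφ_br, mul_sub, sub_mul]
  have hψ_inner (X Y : g) : ⟪X, Y⟫_ℝ = soFiveForm (ψ X) (ψ Y) := by
    have h : gramInv * ψ X * gramInv * ψ Y = gramInv * U * (φ X * φ Y) * Uᵀ := by
      rw [mul_assoc gramInv, mul_assoc gramInv, hψ_mul]
      simp only [mul_assoc]
    have h' : Uᵀ * (gramInv * U * (φ X * φ Y)) = φ X * φ Y := by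
      rw [← mul_assoc, ← mul_assoc Uᵀ, hU, one_mul]
    rw [hQ, soFiveForm, h, trace_mul_comm _ Uᵀ, h']
  have hex (k : Fin 3) : ∃ X : g, ∀ v, e ((φ X).mulVec v)
      = soThreeBasis k * e v - e v * soThreeBasis k := by
    obtain ⟨N, hN, hNe⟩ :=
      exists_skew_mulVec_eq_commutator e he_range he_inner (soThreeBasis_transpose k)
    obtain ⟨X, rfl⟩ := (hφ_range N).2 hN
    exact ⟨X, hNe⟩
  choose h hh using hex
  have hmem (k : Fin 3) : h k ∈ H := (hH _).2 ⟨_, soThreeBasis_transpose k, hh k⟩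
  have hψ_h (k : Fin 3) : ψ (h k) = soThreeAction k := by
    ext i j
    rw [← trace_soThreeBasis_action, ← hUe, ← hUe, ← hh, ← he_inner]
    simp only [ψ, mul_assoc]
    rfl
  have horth (k l : Fin 3) : ⟪h k, h l⟫_ℝ = if k = l then 1 else 0 := by
    rw [hψ_inner, hψ_h, hψ_h, soFiveForm_soThreeAction]
  have hspan (X : g) (hX : X ∈ H) : ∃ c : Fin 3 → ℝ, X = ∑ k, c k • h k := by
    obtain ⟨A, hA, hXA⟩ := (hH X).1 hX
    obtain ⟨c, rfl⟩ := exists_eq_sum_soThreeBasis hA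
    refine ⟨c, hφ_inj ?_⟩
    refine Matrix.ext_iff_mulVec.2 fun v => he_inj ?_
    rw [hXA]
    simp only [map_sum, map_smul, Matrix.sum_mulVec, Matrix.smul_mulVec, hh, Finset.sum_mul,
      Finset.mul_sum, smul_mul_assoc, mul_smul_comm, smul_sub, Finset.sum_sub_distrib]
  have hbr_self (X : g) : br X X = 0 := hφ_inj (by rw [hφ_br, sub_self, map_zero])
  let m : ↥Hᗮ →ₗ[ℝ] ↥Hᗮ →ₗ[ℝ] g := br.domRestrict₁₂ Hᗮ Hᗮ
  have hm (X Y : ↥Hᗮ) : m X Y = br X Y := rfl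
  have hcross (X Y : ↥Hᗮ) : ⟪X, X⟫_ℝ * ⟪Y, Y⟫_ℝ - ⟪X, Y⟫_ℝ * ⟪Y, X⟫_ℝ
      - ⟪m X Y, m X Y⟫_ℝ + ⟪m.compr₂ P X Y, m.compr₂ P X Y⟫_ℝ = 0 := by
    have hperp (X : ↥Hᗮ) (k : Fin 3) : soFiveForm (ψ X) (soThreeAction k) = 0 := by
      rw [← hψ_h, ← hψ_inner]
      exact Submodule.inner_left_of_mem_orthogonal (hmem k) X.2
    have key := soFiveForm_bracket (hψ_skew X) (hψ_skew Y) (hperp X) (hperp Y) (hψ_br X Y)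
    simp only [← hψ_h, ← hψ_inner] at key
    rw [← inner_projection_self_eq_sum hmem horth hspan (hP_mem _) (hP_perp (br X Y))] at key
    rw [real_inner_comm X Y, LinearMap.compr₂_apply, hm]
    simp only [Submodule.coe_inner]
    linarith
  obtain ⟨ω, hω⟩ := M.exists_inner_wedge4_eq (crossProductForm m (m.compr₂ P)
    (fun X => hbr_self X) (fun X => by rw [LinearMap.compr₂_apply, hm, hbr_self, map_zero]) hcross)
  refine ⟨(1 / 4 : ℝ) • ω, M.isPosDef_of_inner_wedge2 _ (fun X Y => P (br X Y))
    (a := 1 / 4) (by norm_num) fun X Y Z W => ?_⟩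
  have hXYZW : ⟪ω, M.wedge4 X Y Z W⟫_ℝ = ⟪X, Z⟫_ℝ * ⟪Y, W⟫_ℝ - ⟪X, W⟫_ℝ * ⟪Y, Z⟫_ℝ
      - ⟪br (X : g) Y, br (Z : g) W⟫_ℝ + ⟪P (br (X : g) Y), P (br (Z : g) W)⟫_ℝ :=
    hω ![X, Y, Z, W]
  rw [LinearMap.add_apply, inner_add_left, hRhat, M.toOp_spec, real_inner_smul_left, hXYZW,
    M.inner_wedge2]
  ring
end
end

section
/- Non-uniqueness of positive-semidefinite modifications in dimension 5: let V = ℝ⁵ = ℝ⁴ ⊕ ℝ with the standard inner product, and let R be the self-adjoint operator on Λ²V given by ⟨R(X∧Y), Z∧W⟩ = ⟨X',Z'⟩⟨Y',W'⟩ − ⟨X',W'⟩⟨Y',Z'⟩, where X' denotes the component of X in ℝ⁴ (R is the curvature operator of the product metric on S⁴ × ℝ at any point; it is positive-semidefinite). Let vol₄ ∈ Λ⁴V be the volume form of the ℝ⁴ factor. Then there exists ε₀ > 0 such that for every ε with |ε| ≤ ε₀, the operator R + ε·vol₄ is positive-semidefinite; in particular, there is more than one ω ∈ Λ⁴V making R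 + ω positive-semidefinite. -/
/- Common setup: an abstract model of the second and fourth exterior powers
`Λ²V` and `Λ⁴V` of a real inner product space `V`, with the induced inner
products, the identification of 4-vectors with self-adjoint operators on
`Λ²V`, and the Bianchi map. -/

noncomputable section

open scoped InnerProductSpace

namespace ExtModel

variable {V E2 E4 : Type*} [NormedAddCommGroup V] [InnerProductSpace ℝ V]
  [NormedAddCommGroup E2] [InnerProductSpace ℝ E2]
  [NormedAddCommGroup E4] [InnerProductSpace ℝ E4]

/-- Bilinear forms on `Λ²V` that agree on decomposable bivectors are equal. -/
theorem bilin_ext (M : ExtModel V E2 E4) {B C : E2 →ₗ[ℝ] E2 →ₗ[ℝ] ℝ}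
    (h : ∀ X Y Z W : V,
      B (M.wedge2 X Y) (M.wedge2 Z W) = C (M.wedge2 X Y) (M.wedge2 Z W)) : B = C := by
  refine LinearMap.ext_on M.span_wedge2 ?_
  rintro _ ⟨X, Y, rfl⟩
  refine LinearMap.ext_on M.span_wedge2 ?_
  rintro _ ⟨Z, W, rfl⟩
  exact h X Y Z W

/-- The coordinate of a bivector along `eᵢ ∧ eⱼ`. -/
def coord {n : ℕ} (M : ExtModel (EuclideanSpace ℝ (Fin n)) E2 E4) (i j : Fin n) :
    E2 →ₗ[ℝ] ℝ :=
  innerₗ E2 (M.wedge2 (EuclideanSpace.single i 1) (EuclideanSpace.single j 1))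

theorem coord_wedge2 {n : ℕ} (M : ExtModel (EuclideanSpace ℝ (Fin n)) E2 E4) (i j : Fin n)
    (X Y : EuclideanSpace ℝ (Fin n)) :
    M.coord i j (M.wedge2 X Y) = X i * Y j - Y i * X j := by
  simp [coord, M.inner_wedge2, EuclideanSpace.inner_single_left]

/-- The curvature operator of `S⁴ × ℝ` is the sum of squares of the coordinates along the
`ℝ⁴` factor. -/
theorem inner_curvature_apply_self (M : ExtModel (EuclideanSpace ℝ (Fin 5)) E2 E4)
    (P : EuclideanSpace ℝ (Fin 5) →ₗ[ℝ] EuclideanSpace ℝ (Fin 5))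
    (hP : ∀ (v : EuclideanSpace ℝ (Fin 5)) (i : Fin 5),
      P v i = if (i : ℕ) < 4 then v i else 0)
    (R : E2 →ₗ[ℝ] E2)
    (hR : ∀ X Y Z W : EuclideanSpace ℝ (Fin 5),
      ⟪R (M.wedge2 X Y), M.wedge2 Z W⟫_ℝ
        = ⟪P X, P Z⟫_ℝ * ⟪P Y, P W⟫_ℝ - ⟪P X, P W⟫_ℝ * ⟪P Y, P Z⟫_ℝ) (v : E2) :
    ⟪R v, v⟫_ℝ = M.coord 0 1 v ^ 2 + M.coord 0 2 v ^ 2 + M.coord 0 3 v ^ 2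
      + M.coord 1 2 v ^ 2 + M.coord 1 3 v ^ 2 + M.coord 2 3 v ^ 2 := by
  let sq (i j : Fin 5) := (M.coord i j).smulRight (M.coord i j)
  have h : innerₗ E2 ∘ₗ R = sq 0 1 + sq 0 2 + sq 0 3 + sq 1 2 + sq 1 3 + sq 2 3 := by
    refine M.bilin_ext fun X Y Z W => ?_
    have hin (x y : EuclideanSpace ℝ (Fin 5)) :
        ⟪P x, P y⟫_ℝ = x 0 * y 0 + x 1 * y 1 + x 2 * y 2 + x 3 * y 3 := by
      simp [PiLp.inner_apply, Fin.sum_univ_five, hP]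
      ring
    simp only [sq, LinearMap.comp_apply, LinearMap.add_apply, LinearMap.smulRight_apply,
      LinearMap.smul_apply, smul_eq_mul, coord_wedge2, innerₗ_apply_apply, hR, hin]
    ring
  have := LinearMap.congr_fun₂ h v v
  simp only [sq, LinearMap.comp_apply, LinearMap.add_apply, LinearMap.smulRight_apply,
    LinearMap.smul_apply, smul_eq_mul, innerₗ_apply_apply] at this
  rw [this]
  ring

/-- The operator of the volume form of the `ℝ⁴` factor is twice the Pfaffian of the coordinates
along that factor. -/
theorem inner_toOp_vol_apply_self (M : ExtModel (EuclideanSpace ℝ (Fin 5)) E2 E4) (vol₄ : E4)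
    (hvol₄ : ∀ X Y Z W : EuclideanSpace ℝ (Fin 5),
      ⟪vol₄, M.wedge4 X Y Z W⟫_ℝ
        = Matrix.det (Matrix.of fun i j : Fin 4 =>
            (![X, Y, Z, W] j) (Fin.castSucc i))) (v : E2) :
    ⟪M.toOp vol₄ v, v⟫_ℝ = 2 * (M.coord 0 1 v * M.coord 2 3 v - M.coord 0 2 v * M.coord 1 3 v
      + M.coord 0 3 v * M.coord 1 2 v) := by
  let mul (i j k l : Fin 5) := (M.coord i j).smulRight (M.coord k l)
  have h : innerₗ E2 ∘ₗ M.toOp vol₄ = mul 0 1 2 3 + mul 2 3 0 1 - mul 0 2 1 3 - mul 1 3 0 2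
      + mul 0 3 1 2 + mul 1 2 0 3 := by
    refine M.bilin_ext fun X Y Z W => ?_
    have h0 : Fin.castSucc (0 : Fin 4) = 0 := rfl
    have h1 : Fin.castSucc (1 : Fin 4) = 1 := rfl
    have h2 : Fin.castSucc (2 : Fin 4) = 2 := rfl
    have h3 : Fin.castSucc (3 : Fin 4) = 3 := rfl
    have hdet (A : Matrix (Fin 4) (Fin 4) ℝ) : A.det =
        (A 0 0 * A 1 1 - A 1 0 * A 0 1) * (A 2 2 * A 3 3 - A 3 2 * A 2 3)
        - (A 0 0 * A 2 1 - A 2 0 * A 0 1) * (A 1 2 * A 3 3 - A 3 2 * A 1 3)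
        + (A 0 0 * A 3 1 - A 3 0 * A 0 1) * (A 1 2 * A 2 3 - A 2 2 * A 1 3)
        + (A 1 0 * A 2 1 - A 2 0 * A 1 1) * (A 0 2 * A 3 3 - A 3 2 * A 0 3)
        - (A 1 0 * A 3 1 - A 3 0 * A 1 1) * (A 0 2 * A 2 3 - A 2 2 * A 0 3)
        + (A 2 0 * A 3 1 - A 3 0 * A 2 1) * (A 0 2 * A 1 3 - A 1 2 * A 0 3) := by
      simp [Matrix.det_succ_row_zero, Fin.sum_univ_succ, Fin.succAbove]
      ring
    simp only [mul, LinearMap.comp_apply, LinearMap.add_apply, LinearMap.sub_apply,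
      LinearMap.smulRight_apply, LinearMap.smul_apply, smul_eq_mul, coord_wedge2,
      innerₗ_apply_apply, M.toOp_spec, hvol₄, hdet, Matrix.of_apply, Matrix.cons_val, h0, h1, h2,
      h3]
    ring
  have := LinearMap.congr_fun₂ h v v
  simp only [mul, LinearMap.comp_apply, LinearMap.add_apply, LinearMap.sub_apply,
    LinearMap.smulRight_apply, LinearMap.smul_apply, smul_eq_mul, innerₗ_apply_apply] at this
  rw [this]
  ring

end ExtModel

/-- Non-uniqueness of positive-semidefinite modifications
in dimension 5. Let `V = ℝ⁵ = ℝ⁴ ⊕ ℝ` with the standard inner product, `P`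
the orthogonal projection onto the `ℝ⁴` factor (so `P X = X'`), and let `R`
be the self-adjoint operator on `Λ²V` given by
`⟪R(X∧Y), Z∧W⟫ = ⟪X',Z'⟫⟪Y',W'⟫ − ⟪X',W'⟫⟪Y',Z'⟫` (the curvature operator of
the product metric on `S⁴ × ℝ`; it is positive-semidefinite). Let
`vol₄ ∈ Λ⁴V` be the volume form of the `ℝ⁴` factor. Then there exists
`ε₀ > 0` such that for every `ε` with `|ε| ≤ ε₀` the operator `R + ε·vol₄` is
positive-semidefinite; in particular there is more than one `ω ∈ Λ⁴V` making
`R + ω` positive-semidefinite. -/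
theorem nonuniqueness_dim_five
    {E2 E4 : Type*}
    [NormedAddCommGroup E2] [InnerProductSpace ℝ E2] [FiniteDimensional ℝ E2]
    [NormedAddCommGroup E4] [InnerProductSpace ℝ E4] [FiniteDimensional ℝ E4]
    (M : ExtModel (EuclideanSpace ℝ (Fin 5)) E2 E4)
    (P : EuclideanSpace ℝ (Fin 5) →ₗ[ℝ] EuclideanSpace ℝ (Fin 5))
    (hP : ∀ (v : EuclideanSpace ℝ (Fin 5)) (i : Fin 5),
      P v i = if (i : ℕ) < 4 then v i else 0)
    (R : E2 →ₗ[ℝ] E2) (hR_sym : R.IsSymmetric)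
    (hR : ∀ X Y Z W : EuclideanSpace ℝ (Fin 5),
      ⟪R (M.wedge2 X Y), M.wedge2 Z W⟫_ℝ
        = ⟪P X, P Z⟫_ℝ * ⟪P Y, P W⟫_ℝ - ⟪P X, P W⟫_ℝ * ⟪P Y, P Z⟫_ℝ)
    (vol₄ : E4)
    (hvol₄ : ∀ X Y Z W : EuclideanSpace ℝ (Fin 5),
      ⟪vol₄, M.wedge4 X Y Z W⟫_ℝ
        = Matrix.det (Matrix.of fun i j : Fin 4 =>
            (![X, Y, Z, W] j) (Fin.castSucc i))) :
    (∃ ε₀ : ℝ, 0 < ε₀ ∧ ∀ ε : ℝ, |ε| ≤ ε₀ → IsPosSemidef (R + M.toOp (ε • vol₄))) ∧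
    (∃ ω₁ ω₂ : E4, ω₁ ≠ ω₂ ∧
      IsPosSemidef (R + M.toOp ω₁) ∧ IsPosSemidef (R + M.toOp ω₂)) := by
  have key (ε : ℝ) (hε : |ε| ≤ 1) : IsPosSemidef (R + M.toOp (ε • vol₄)) := by
    intro v
    obtain ⟨h₁, h₂⟩ := abs_le.mp hε
    rw [LinearMap.add_apply, inner_add_left, map_smul, LinearMap.smul_apply, real_inner_smul_left,
      M.inner_curvature_apply_self P hP R hR, M.inner_toOp_vol_apply_self vol₄ hvol₄]
    generalize M.coord 0 1 v = a, M.coord 2 3 v = b, M.coord 0 2 v = c, M.coord 1 3 v = d,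
      M.coord 0 3 v = e, M.coord 1 2 v = f
    have hadd : 0 ≤ (1 + ε) * ((a + b) ^ 2 + (c - d) ^ 2 + (e + f) ^ 2) :=
      mul_nonneg (by linarith) (by positivity)
    have hsub : 0 ≤ (1 - ε) * ((a - b) ^ 2 + (c + d) ^ 2 + (e - f) ^ 2) :=
      mul_nonneg (by linarith) (by positivity)
    linarith
  have hne : vol₄ ≠ 0 := by
    rintro rfl
    have h := hvol₄ (EuclideanSpace.single 0 1) (EuclideanSpace.single 1 1)
      (EuclideanSpace.single 2 1) (EuclideanSpace.single 3 1)
    have hone : (Matrix.of fun i j : Fin 4 =>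
        ((![EuclideanSpace.single 0 1, EuclideanSpace.single 1 1, EuclideanSpace.single 2 1,
          EuclideanSpace.single 3 1] : Fin 4 → EuclideanSpace ℝ (Fin 5)) j) (Fin.castSucc i))
        = 1 := by
      ext i j
      fin_cases i <;> fin_cases j <;> simp
    rw [hone, Matrix.det_one, inner_zero_left] at h
    exact zero_ne_one h
  refine ⟨⟨1, one_pos, key⟩, vol₄, 0, hne, ?_, ?_⟩
  · simpa using key 1 (by simp)
  · simpa using key 0 (by simp)
end
end
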